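/- Let N ∪ {Γ → E[x]_{p,q}} ⇒_LI N ∪ {Γ{x ↦ x'}, Γ → E[x']_q} be a Linear transformation. Any Herbrand model I of N ∪ {Γ{x ↦ x'}, Γ → E[x']_q} is also a Herbrand model of N ∪ {Γ → E[x]_{p,q}}; hence the Linear transformation is an over-approximation. -/

import Mathlib

namespace FOApprox

/-- First-order terms over a countable signature of function symbols. -/
inductive Tm : Type where
  | var : ℕ → Tm
  | fn : ℕ → List Tm → Tm

/-- Atoms: a predicate symbol applied to a list of terms. -/
structure Atom : Type where
  pred : ℕ
  args : List Tm

/-- Substitutions map variables to terms. -/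
abbrev Subst := ℕ → Tm

mutual
/-- Application of a substitution to a term. -/
def Tm.subst (σ : Subst) : Tm → Tm
  | .var x => σ x
  | .fn f ts => .fn f (Tm.substList σ ts)
def Tm.substList (σ : Subst) : List Tm → List Tm
  | [] => []
  | t :: ts => Tm.subst σ t :: Tm.substList σ ts
end

def Atom.subst (σ : Subst) (A : Atom) : Atom := ⟨A.pred, Tm.substList σ A.args⟩

/-- A clause Γ → Δ: `neg` is the multiset Γ of negative atoms,
`pos` the multiset Δ of positive atoms. -/
structure Clause : Type where
  neg : Multiset Atom
  pos : Multiset Atom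

def Clause.subst (σ : Subst) (C : Clause) : Clause :=
  ⟨C.neg.map (Atom.subst σ), C.pos.map (Atom.subst σ)⟩

/-- A term is ground if it is invariant under all substitutions. -/
def Tm.Ground (t : Tm) : Prop := ∀ σ : Subst, t.subst σ = t

def Clause.Ground (C : Clause) : Prop := ∀ σ : Subst, C.subst σ = C

/-- A grounding substitution maps every variable to a ground term. -/
def Subst.Grounding (σ : Subst) : Prop := ∀ x, (σ x).Ground

/-- A Herbrand interpretation `I` (a set of ground atoms) satisfies a clause
Γ → Δ if for every grounding substitution σ, Δσ ∩ I ≠ ∅ or Γσ ⊄ I. -/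
def SatClause (I : Set Atom) (C : Clause) : Prop :=
  ∀ σ : Subst, σ.Grounding →
    (∃ A ∈ C.pos, A.subst σ ∈ I) ∨ (∃ A ∈ C.neg, A.subst σ ∉ I)

def Models (I : Set Atom) (N : Set Clause) : Prop := ∀ C ∈ N, SatClause I C

def Satisfiable (N : Set Clause) : Prop := ∃ I : Set Atom, Models I N

/-- Apply a substitution to all clauses of a set (variables are shared). -/
def SubstSet (σ : Subst) (N : Set Clause) : Set Clause := Clause.subst σ '' N

/-- A finite clause set is a conflicting core if all its simultaneous ground
instances are unsatisfiable. -/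
def ConflictingCore (Nb : Set Clause) : Prop :=
  Nb.Finite ∧ ∀ τ : Subst, τ.Grounding → ¬ Satisfiable (SubstSet τ Nb)

/-- `Nb` is a conflicting core of `N`: additionally every clause of `Nb`
is an instance of a clause of `N`. -/
def ConflictingCoreOf (Nb N : Set Clause) : Prop :=
  ConflictingCore Nb ∧ ∀ C ∈ Nb, ∃ C' ∈ N, ∃ σ : Subst, C = Clause.subst σ C'

/-- An atom occurs (positively or negatively) in a clause. -/
def AtomIn (A : Atom) (C : Clause) : Prop := A ∈ C.neg ∨ A ∈ C.pos

mutual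
def Tm.fns : Tm → List ℕ
  | .var _ => []
  | .fn f ts => f :: Tm.fnsList ts
def Tm.fnsList : List Tm → List ℕ
  | [] => []
  | t :: ts => Tm.fns t ++ Tm.fnsList ts
end

mutual
def Tm.vars : Tm → List ℕ
  | .var x => [x]
  | .fn _ ts => Tm.varsList ts
def Tm.varsList : List Tm → List ℕ
  | [] => []
  | t :: ts => Tm.vars t ++ Tm.varsList ts
end

def VarInClause (x : ℕ) (C : Clause) : Prop :=
  ∃ A, AtomIn A C ∧ ∃ t ∈ A.args, x ∈ Tm.vars t

def FnInClause (f : ℕ) (C : Clause) : Prop :=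
  ∃ A, AtomIn A C ∧ ∃ t ∈ A.args, f ∈ Tm.fns t

def PredInClause (P : ℕ) (C : Clause) : Prop := ∃ A, AtomIn A C ∧ A.pred = P

def PredIn (P : ℕ) (N : Set Clause) : Prop := ∃ C ∈ N, PredInClause P C

def PredNotIn (P : ℕ) (N : Set Clause) : Prop := ∀ C ∈ N, ¬ PredInClause P C

def FnNotIn (f : ℕ) (N : Set Clause) : Prop := ∀ C ∈ N, ¬ FnInClause f C

def VarNotInClause (x : ℕ) (C : Clause) : Prop := ¬ VarInClause x C

/-- Subterm of a term at a position. -/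
def Tm.atPos : List ℕ → Tm → Option Tm
  | [], t => some t
  | _ :: _, .var _ => none
  | i :: p, .fn _ ts => (ts[i]?).bind (Tm.atPos p)

/-- Replace the subterm at a position in a term. -/
def Tm.replaceAt : List ℕ → Tm → Tm → Option Tm
  | [], _, u => some u
  | _ :: _, .var _, _ => none
  | i :: p, .fn f ts, u =>
    (ts[i]?).bind fun t => (Tm.replaceAt p t u).map fun t' => Tm.fn f (ts.set i t')

/-- Subterm of an atom at a position: the head of the position selects an
argument, the tail a position inside that argument. A position of length 1
is a top position. -/
def Atom.atPos (A : Atom) : List ℕ → Option Tm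
  | [] => none
  | i :: p => (A.args[i]?).bind (Tm.atPos p)

def Atom.replaceAt (A : Atom) : List ℕ → Tm → Option Atom
  | [], _ => none
  | i :: p, u =>
    (A.args[i]?).bind fun t =>
      (Tm.replaceAt p t u).map fun t' => ⟨A.pred, A.args.set i t'⟩

/-- A complex term is a non-variable term. -/
def Tm.Complex : Tm → Prop
  | .var _ => False
  | .fn _ _ => True

mutual
/-- Skeleton computation with a fresh-variable counter. -/
def Tm.sktAux : Tm → ℕ → Tm × ℕ
  | .var _, n => (.var n, n + 1)
  | .fn f ts, n =>
    let r := Tm.sktAuxList ts n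
    (.fn f r.1, r.2)
def Tm.sktAuxList : List Tm → ℕ → List Tm × ℕ
  | [], n => ([], n)
  | t :: ts, n =>
    let r := Tm.sktAux t n
    let r' := Tm.sktAuxList ts r.2
    (r.1 :: r'.1, r'.2)
end

/-- The term skeleton: every variable occurrence is replaced by a distinct
fresh variable. -/
def Tm.skeleton (t : Tm) : Tm := (Tm.sktAux t 0).1

/-- The projection μ_P on atoms: replaces P(t₁,…,tₙ) by T(f_P(t₁,…,tₙ)). -/
def projAtom (P T f : ℕ) (A : Atom) : Atom :=
  if A.pred = P then ⟨T, [Tm.fn f A.args]⟩ else A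

def projClause (P T f : ℕ) (C : Clause) : Clause :=
  ⟨C.neg.map (projAtom P T f), C.pos.map (projAtom P T f)⟩

def projSet (P T f : ℕ) (N : Set Clause) : Set Clause := projClause P T f '' N

/-- The reverse projection μ_P⁻¹ on Herbrand interpretations. -/
def projInvInterp (P T f : ℕ) (I : Set Atom) : Set Atom := projAtom P T f ⁻¹' I

/-- The reverse projection μ_P⁻¹ on atoms: T(f_P(t₁,…,tₙ)) is mapped back
to P(t₁,…,tₙ), all other atoms are unchanged. -/
def unprojAtom (P T f : ℕ) (A : Atom) : Atom :=
  match A with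
  | ⟨Q, [Tm.fn g ts]⟩ => if Q = T ∧ g = f then ⟨P, ts⟩ else ⟨Q, [Tm.fn g ts]⟩
  | A => A

def unprojClause (P T f : ℕ) (C : Clause) : Clause :=
  ⟨C.neg.map (unprojAtom P T f), C.pos.map (unprojAtom P T f)⟩

/-- The substitution {x ↦ x'}. -/
def singleSubst (x x' : ℕ) : Subst := fun y => if y = x then Tm.var x' else Tm.var y

/-- Monadic transformation step (T is the fixed projection predicate,
`fp P` the projection function symbol for the predicate `P`). -/
def MOStep (T : ℕ) (fp : ℕ → ℕ) (N N' : Set Clause) : Prop :=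
  ∃ (P : ℕ) (C C' : Clause) (A : Atom) (M : Multiset Atom),
    C ∈ N ∧ A.pred = P ∧ P ≠ T ∧ 2 ≤ A.args.length ∧
    ((C.neg = A ::ₘ M ∧ C'.neg = (projAtom P T (fp P) A) ::ₘ M ∧ C'.pos = C.pos) ∨
     (C.pos = A ::ₘ M ∧ C'.pos = (projAtom P T (fp P) A) ::ₘ M ∧ C'.neg = C.neg)) ∧
    N' = (N \ {C}) ∪ {C'}

/-- Horn transformation step: replace Γ → E₁,…,Eₙ (n > 1) by Γ → Eᵢ. -/
def HOStep (N N' : Set Clause) : Prop :=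
  ∃ (C : Clause) (E : Atom),
    C ∈ N ∧ E ∈ C.pos ∧ 2 ≤ Multiset.card C.pos ∧
    N' = (N \ {C}) ∪ {⟨C.neg, {E}⟩}

/-- Shallow transformation step: replace Γ₁,Γ₂ → E[s]_p (s complex, p not a
top position) by S(x), Γ₁ → E[x]_p and Γ₂ → S(s), with S, x fresh. -/
def SHStep (N N' : Set Clause) : Prop :=
  ∃ (Γ₁ Γ₂ : Multiset Atom) (E E' : Atom) (p : List ℕ) (s : Tm) (S x : ℕ),
    (⟨Γ₁ + Γ₂, {E}⟩ : Clause) ∈ N ∧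
    E.atPos p = some s ∧ Tm.Complex s ∧ 2 ≤ p.length ∧
    PredNotIn S N ∧ VarNotInClause x ⟨Γ₁ + Γ₂, {E}⟩ ∧
    E.replaceAt p (Tm.var x) = some E' ∧
    N' = (N \ {(⟨Γ₁ + Γ₂, {E}⟩ : Clause)}) ∪
      {(⟨(⟨S, [Tm.var x]⟩ : Atom) ::ₘ Γ₁, {E'}⟩ : Clause),
       (⟨Γ₂, {(⟨S, [s]⟩ : Atom)}⟩ : Clause)}

/-- Linear transformation step: replace Γ → E[x]_{p,q} by
Γ{x ↦ x'}, Γ → E[x']_q with x' fresh. -/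
def LIStep (N N' : Set Clause) : Prop :=
  ∃ (Γ : Multiset Atom) (E E' : Atom) (p q : List ℕ) (x x' : ℕ),
    (⟨Γ, {E}⟩ : Clause) ∈ N ∧ p ≠ q ∧
    E.atPos p = some (Tm.var x) ∧ E.atPos q = some (Tm.var x) ∧
    VarNotInClause x' ⟨Γ, {E}⟩ ∧
    E.replaceAt q (Tm.var x') = some E' ∧
    N' = (N \ {(⟨Γ, {E}⟩ : Clause)}) ∪
      {(⟨Γ.map (Atom.subst (singleSubst x x')) + Γ, {E'}⟩ : Clause)}

/-- Applicability of the Monadic transformation: a non-monadic atom occurs. -/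
def MOApp (N : Set Clause) : Prop := ∃ C ∈ N, ∃ A, AtomIn A C ∧ 2 ≤ A.args.length

/-- Applicability of the Horn transformation: a non-Horn clause occurs. -/
def HOApp (N : Set Clause) : Prop := ∃ C ∈ N, 2 ≤ Multiset.card C.pos

/-- Applicability of the Shallow transformation. -/
def SHApp (N : Set Clause) : Prop :=
  ∃ C ∈ N, ∃ E ∈ C.pos, ∃ (p : List ℕ) (s : Tm),
    E.atPos p = some s ∧ Tm.Complex s ∧ 2 ≤ p.length

/-- Applicability of the Linear transformation. -/
def LIApp (N : Set Clause) : Prop :=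
  ∃ C ∈ N, ∃ E ∈ C.pos, ∃ (p q : List ℕ) (x : ℕ),
    p ≠ q ∧ E.atPos p = some (Tm.var x) ∧ E.atPos q = some (Tm.var x)

/-- The approximation relation ⇒_apr: the union of the four transformations,
Monadic preceding Horn preceding Shallow preceding Linear. -/
def Apr (T : ℕ) (fp : ℕ → ℕ) (N N' : Set Clause) : Prop :=
  MOStep T fp N N' ∨
  (¬ MOApp N ∧ HOStep N N') ∨
  (¬ MOApp N ∧ ¬ HOApp N ∧ SHStep N N') ∨
  (¬ MOApp N ∧ ¬ HOApp N ∧ ¬ SHApp N ∧ LIStep N N')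

/-- Reflexive-transitive closure of ⇒_apr. -/
def AprStar (T : ℕ) (fp : ℕ → ℕ) : Set Clause → Set Clause → Prop :=
  Relation.ReflTransGen (Apr T fp)

/-- Freshness of the projection symbols for a clause set: `fp` is injective,
`T` and the symbols `fp P` do not occur in `N`. -/
def FreshFor (T : ℕ) (fp : ℕ → ℕ) (N : Set Clause) : Prop :=
  Function.Injective fp ∧ PredNotIn T N ∧ ∀ P, FnNotIn (fp P) N

/-- Minimal Herbrand model with respect to set inclusion. -/
def MinimalModel (I : Set Atom) (N : Set Clause) : Prop :=
  Models I N ∧ ∀ J : Set Atom, J ⊂ I → ¬ Models J N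

/-- A clause set is monadic if all predicates have at most one argument. -/
def MonadicSet (N : Set Clause) : Prop :=
  ∀ C ∈ N, ∀ A, AtomIn A C → A.args.length ≤ 1

end FOApprox
namespace FOApprox

/-- Entailment of a clause implication: every Herbrand model of `M`
satisfying `C₁` also satisfies `C₂`. -/
def EntailsClauseImp (M : Set Clause) (C₁ C₂ : Clause) : Prop :=
  ∀ I : Set Atom, Models I M → SatClause I C₁ → SatClause I C₂

/-- The set of unit clauses expressing the negation of a clause. -/
def NegClauses (C : Clause) : Set Clause :=
  {D | ∃ A ∈ C.neg, D = ⟨0, {A}⟩} ∪ {D | ∃ A ∈ C.pos, D = ⟨{A}, 0⟩}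

/-- A substitution is a (variable) renaming. -/
def IsRenaming (σ : Subst) : Prop :=
  (∀ x, ∃ y, σ x = Tm.var y) ∧ Function.Injective σ

/-- The clauses of `N` are pairwise variable disjoint. -/
def PairwiseVarDisjoint (N : Set Clause) : Prop :=
  ∀ C ∈ N, ∀ D ∈ N, C ≠ D → ∀ x, VarInClause x C → ¬ VarInClause x D

/-- `R` is a resolvent on an `S`-literal of two clauses from `Nb`. -/
def SResolvent (S : ℕ) (Nb : Set Clause) (R : Clause) : Prop :=
  ∃ D₁ ∈ Nb, ∃ D₂ ∈ Nb, ∃ (A : Atom) (M₁ M₂ : Multiset Atom),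
    A.pred = S ∧ D₁.neg = A ::ₘ M₁ ∧ D₂.pos = A ::ₘ M₂ ∧
    R = ⟨M₁ + D₂.neg, D₁.pos + M₂⟩

/-- The set of ground instances of clauses of `N`. -/
def GroundInstances (N : Set Clause) : Set Clause :=
  {D | (∃ C ∈ N, ∃ σ : Subst, D = Clause.subst σ C) ∧ D.Ground}

/-- `A` is the strictly maximal atom of `D`, occurring positively. -/
def StrictlyMaxIn (altlt : Atom → Atom → Prop) (A : Atom) (D : Clause) : Prop :=
  ∃ M, D.pos = A ::ₘ M ∧ ∀ B ∈ D.neg + M, altlt B A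

/-- The productive atoms δ_D of a ground clause, defined by well-founded
recursion along the ground clause ordering. -/
noncomputable def delta (Ng : Set Clause) (altlt : Atom → Atom → Prop)
    {clt : Clause → Clause → Prop} (wf : WellFounded clt) : Clause → Set Atom :=
  WellFounded.fix (C := fun _ => Set Atom) wf fun D IH =>
    {A | D ∈ Ng ∧ StrictlyMaxIn altlt A D ∧
      ¬ SatClause (⋃ D', ⋃ (h : clt D' D), IH D' h) D}

/-- The superposition partial minimal model operator I_N. -/
noncomputable def partialModel (N : Set Clause) (altlt : Atom → Atom → Prop)
    {clt : Clause → Clause → Prop} (wf : WellFounded clt) : Set Atom :=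
  ⋃ C ∈ GroundInstances N, delta (GroundInstances N) altlt wf C

/-- The hypothesis of the direct Horn lifting lemma for the Horn step
replacing `C₀` (the non-Horn ancestor) by `C₁`, with conflicting core `Nb`. -/
def DirectHornHyp (Nk : Set Clause) (C₀ C₁ : Clause) (Nb : Set Clause) : Prop :=
  ∃ (m : ℕ) (σ σ' τ : Fin m → Subst) (Nsub : Fin m → Set Clause),
    (∀ j, Clause.subst (σ j) C₁ ∈ Nb) ∧
    (∀ D ∈ Nb, (∃ ρ : Subst, D = Clause.subst ρ C₁) →
      ∃ j, D = Clause.subst (σ j) C₁) ∧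
    (∀ j, Nsub j ⊆ Nk) ∧
    (∀ j, EntailsClauseImp (SubstSet (τ j) (Nsub j))
      (Clause.subst (σ' j) C₀) (Clause.subst (σ j) C₁)) ∧
    (∀ j, ConflictingCore (SubstSet (τ j) (Nsub j) ∪
      {Clause.subst (σ' j) C₀} ∪ NegClauses (Clause.subst (σ j) C₁)))

end FOApprox

namespace FOApprox

theorem Tm.substList_eq_map (σ : Subst) (ts : List Tm) :
    Tm.substList σ ts = ts.map (Tm.subst σ) := by
  induction ts with
  | nil => rfl
  | cons t ts ih => simp [Tm.substList, ih]

mutual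
/-- Substitutions agreeing on the variables of a term act equally on it, also
after a first substitution. -/
theorem Tm.subst_subst_eq (ρ τ σ : Subst) :
    ∀ t : Tm, (∀ y ∈ t.vars, (ρ y).subst τ = σ y) → (t.subst ρ).subst τ = t.subst σ
  | .var y, h => by
    simpa only [Tm.subst] using h y (by simp [Tm.vars])
  | .fn f ts, h => by
    simp only [Tm.subst]
    rw [Tm.substList_substList_eq ρ τ σ ts fun y hy => h y (by simpa [Tm.vars] using hy)]
theorem Tm.substList_substList_eq (ρ τ σ : Subst) :
    ∀ ts : List Tm, (∀ y ∈ Tm.varsList ts, (ρ y).subst τ = σ y) →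
      Tm.substList τ (Tm.substList ρ ts) = Tm.substList σ ts
  | [], _ => rfl
  | t :: ts, h => by
    simp only [Tm.substList]
    rw [Tm.subst_subst_eq ρ τ σ t fun y hy => h y (by simp [Tm.varsList, hy]),
      Tm.substList_substList_eq ρ τ σ ts fun y hy => h y (by simp [Tm.varsList, hy])]
end

mutual
theorem Tm.subst_var : ∀ t : Tm, t.subst Tm.var = t
  | .var _ => rfl
  | .fn f ts => by simp only [Tm.subst, Tm.substList_var ts]
theorem Tm.substList_var : ∀ ts : List Tm, Tm.substList Tm.var ts = ts
  | [] => rfl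
  | t :: ts => by simp only [Tm.substList, Tm.subst_var t, Tm.substList_var ts]
end

theorem Tm.mem_varsList {y : ℕ} {ts : List Tm} :
    y ∈ Tm.varsList ts ↔ ∃ t ∈ ts, y ∈ t.vars := by
  induction ts with
  | nil => simp [Tm.varsList]
  | cons t ts ih => simp [Tm.varsList, ih]

theorem Atom.subst_subst_eq {ρ τ σ : Subst} {A : Atom}
    (h : ∀ t ∈ A.args, ∀ y ∈ t.vars, (ρ y).subst τ = σ y) :
    (A.subst ρ).subst τ = A.subst σ := by
  simp only [Atom.subst]
  rw [Tm.substList_substList_eq ρ τ σ A.args]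
  intro y hy
  obtain ⟨t, ht, hyt⟩ := Tm.mem_varsList.1 hy
  exact h t ht y hyt

theorem Atom.subst_var (A : Atom) : A.subst Tm.var = A := by
  simp only [Atom.subst, Tm.substList_var]

theorem Atom.subst_congr {τ σ : Subst} {A : Atom}
    (h : ∀ t ∈ A.args, ∀ y ∈ t.vars, τ y = σ y) : A.subst τ = A.subst σ := by
  simpa only [Atom.subst_var] using Atom.subst_subst_eq (ρ := Tm.var) h

theorem List.map_set_of_getElem? {α β : Type*} {f : α → β} {l : List α} {i : ℕ} {a b : α}
    (hi : l[i]? = some a) (hab : f b = f a) : (l.set i b).map f = l.map f := by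
  obtain ⟨hlt, rfl⟩ := List.getElem?_eq_some_iff.1 hi
  rw [List.map_set, hab]
  apply List.ext_getElem <;> simp [List.getElem_set]
  grind

/-- Replacing a subterm by a term with the same instance preserves the instance. -/
theorem Tm.subst_replaceAt {τ : Subst} {s u : Tm} (h : u.subst τ = s.subst τ) :
    ∀ (q : List ℕ) (t t' : Tm), t.atPos q = some s → t.replaceAt q u = some t' →
      t'.subst τ = t.subst τ
  | [], t, t', hs, hr => by
    simp only [Tm.atPos, Tm.replaceAt, Option.some.injEq] at hs hr
    rw [← hr, hs, h]
  | _ :: _, .var _, _, hs, _ => by simp [Tm.atPos] at hs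
  | i :: q, .fn f ts, t', hs, hr => by
    simp only [Tm.atPos, Tm.replaceAt, Option.bind_eq_some_iff, Option.map_eq_some_iff] at hs hr
    obtain ⟨a, ha, hs⟩ := hs
    obtain ⟨b, hb, c, hc, rfl⟩ := hr
    obtain rfl : a = b := Option.some.inj (ha.symm.trans hb)
    simp only [Tm.subst, Tm.substList_eq_map]
    rw [List.map_set_of_getElem? ha (Tm.subst_replaceAt h q a c hs hc)]

theorem Atom.subst_replaceAt {τ : Subst} {s u : Tm} (h : u.subst τ = s.subst τ)
    {q : List ℕ} {A A' : Atom} (hs : A.atPos q = some s) (hr : A.replaceAt q u = some A') :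
    A'.subst τ = A.subst τ := by
  cases q with
  | nil => simp [Atom.atPos] at hs
  | cons i q =>
    simp only [Atom.atPos, Atom.replaceAt, Option.bind_eq_some_iff,
      Option.map_eq_some_iff] at hs hr
    obtain ⟨a, ha, hs⟩ := hs
    obtain ⟨b, hb, c, hc, rfl⟩ := hr
    obtain rfl : a = b := Option.some.inj (ha.symm.trans hb)
    simp only [Atom.subst, Tm.substList_eq_map]
    rw [List.map_set_of_getElem? ha (Tm.subst_replaceAt h q a c hs hc)]

/-- The approximated clause entails the original one. -/
theorem SatClause.of_linear {I : Set Atom} {Γ : Multiset Atom} {E E' : Atom} {q : List ℕ}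
    {x x' : ℕ} (hq : E.atPos q = some (Tm.var x)) (hx' : VarNotInClause x' ⟨Γ, {E}⟩)
    (hrep : E.replaceAt q (Tm.var x') = some E')
    (h : SatClause I ⟨Γ.map (Atom.subst (singleSubst x x')) + Γ, {E'}⟩) :
    SatClause I ⟨Γ, {E}⟩ := by
  intro σ hσ
  have fresh : ∀ A, AtomIn A ⟨Γ, {E}⟩ → ∀ t ∈ A.args, ∀ y ∈ t.vars, y ≠ x' := by
    rintro A hA t ht y hy rfl
    exact hx' ⟨A, hA, t, ht, hy⟩
  let τ : Subst := fun y => if y = x' then σ x else σ y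
  have hτ : τ.Grounding := by
    intro y
    by_cases hy : y = x' <;> simp only [τ, hy, if_true, if_false] <;> exact hσ _
  have agree : ∀ A, AtomIn A ⟨Γ, {E}⟩ → A.subst τ = A.subst σ := fun A hA =>
    Atom.subst_congr fun t ht y hy => if_neg (fresh A hA t ht y hy)
  have hxτ : τ x = σ x := by simp [τ]
  rcases h τ hτ with ⟨A, hA, hAI⟩ | ⟨A, hA, hAI⟩
  · obtain rfl := Multiset.mem_singleton.1 hA
    refine Or.inl ⟨E, Multiset.mem_singleton_self E, ?_⟩
    rwa [← agree E (Or.inr (Multiset.mem_singleton_self E)),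
      ← Atom.subst_replaceAt (by simp [Tm.subst, τ]) hq hrep]
  · refine Or.inr ?_
    rcases Multiset.mem_add.1 hA with hA | hA
    · obtain ⟨B, hB, rfl⟩ := Multiset.mem_map.1 hA
      refine ⟨B, hB, ?_⟩
      rwa [Atom.subst_subst_eq (σ := σ)] at hAI
      intro t ht y hy
      have hne := fresh B (Or.inl hB) t ht y hy
      by_cases hyx : y = x <;> simp [singleSubst, hyx, Tm.subst, τ]
      intro hyx'
      exact absurd hyx' hne
    · exact ⟨A, hA, by rwa [← agree A (Or.inl hA)]⟩

/-- The Linear transformation is an over-approximation: any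
Herbrand model of N ∪ {Γ{x ↦ x'}, Γ → E[x']_q} is a Herbrand model of
N ∪ {Γ → E[x]_{p,q}}. -/
theorem linear_over_approximation (N : Set Clause) (Γ : Multiset Atom)
    (E E' : Atom) (p q : List ℕ) (x x' : ℕ) (hpq : p ≠ q)
    (hp : E.atPos p = some (Tm.var x)) (hq : E.atPos q = some (Tm.var x))
    (hx' : VarNotInClause x' ⟨Γ, {E}⟩)
    (hrep : E.replaceAt q (Tm.var x') = some E') :
    (∀ I : Set Atom,
        Models I (N ∪ {(⟨Γ.map (Atom.subst (singleSubst x x')) + Γ, {E'}⟩ : Clause)}) →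
        Models I (N ∪ {(⟨Γ, {E}⟩ : Clause)})) ∧
    (Satisfiable (N ∪ {(⟨Γ.map (Atom.subst (singleSubst x x')) + Γ, {E'}⟩ : Clause)}) →
      Satisfiable (N ∪ {(⟨Γ, {E}⟩ : Clause)})) := by
  have key : ∀ I : Set Atom,
      Models I (N ∪ {(⟨Γ.map (Atom.subst (singleSubst x x')) + Γ, {E'}⟩ : Clause)}) →
      Models I (N ∪ {(⟨Γ, {E}⟩ : Clause)}) := by
    rintro I hI C (hC | rfl)
    · exact hI C (Or.inl hC)
    · exact SatClause.of_linear hq hx' hrep (hI _ (Or.inr rfl))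
  exact ⟨key, fun ⟨I, hI⟩ => ⟨I, key I hI⟩⟩

end FOApprox
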